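/- arXiv:math/9809125 — 2 statements merged into one kernel-verified Lean document; each statement's English description precedes it below -/
import Mathlib

section
/- Let a, b be real numbers and k a natural number such that a + b + 1/2 + j ≠ 0 and 2a + 2b + j ≠ 0 for every integer j with 0 ≤ j < k. Then ∑_{j=0}^{k} [(a)_j (b)_j / ((a+b+1/2)_j · j!)] · [(a)_{k-j} (b)_{k-j} / ((a+b+1/2)_{k-j} · (k-j)!)] = (2a)_k (2b)_k (a+b)_k / ((a+b+1/2)_k (2a+2b)_k · k!). This Cauchy-product identity of coefficients is equivalent to Clausen's formula ₂F₁(a,b; a+b+1/2; x)² = ₃F₂(2a,2b,a+b; a+b+1/2, 2a+2b; x). -/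
/-- The Pochhammer symbol (rising factorial) `(x)_k = ∏_{j=0}^{k-1} (x+j)`. -/
def poch (x : ℝ) (k : ℕ) : ℝ :=
  ∏ j ∈ Finset.range k, (x + j)

open Finset in
theorem sum_antidiagonal_add_swap {M : Type*} [AddCommMonoid M] (f : ℕ → ℕ → M) (n : ℕ) :
    ∑ p ∈ antidiagonal n, (f p.1 p.2 + f p.2 p.1) =
      ∑ p ∈ antidiagonal n, f p.1 p.2 + ∑ p ∈ antidiagonal n, f p.1 p.2 := by
  rw [sum_add_distrib]
  congr 1
  exact Nat.sum_antidiagonal_swap (f := fun p : ℕ × ℕ => f p.1 p.2)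

theorem poch_succ (x : ℝ) (k : ℕ) : poch x (k + 1) = poch x k * (x + k) :=
  Finset.prod_range_succ _ _

theorem poch_ne_zero {x : ℝ} {k : ℕ} (h : ∀ j < k, x + (j : ℝ) ≠ 0) : poch x k ≠ 0 :=
  Finset.prod_ne_zero_iff.2 fun j hj => h j (Finset.mem_range.1 hj)

/-- The coefficient of `x ^ j` in the hypergeometric series `₂F₁(a,b; c; x)`. -/
noncomputable def gaussCoeff (a b c : ℝ) (j : ℕ) : ℝ :=
  poch a j * poch b j / (poch c j * (Nat.factorial j : ℝ))

theorem gaussCoeff_succ (a b c : ℝ) (i : ℕ) (h : c + (i : ℝ) ≠ 0) :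
    ((i : ℝ) + 1) * (c + i) * gaussCoeff a b c (i + 1) =
      (a + i) * (b + i) * gaussCoeff a b c i := by
  have hi : (i : ℝ) + 1 ≠ 0 := by positivity
  simp only [gaussCoeff, poch_succ, Nat.factorial_succ, Nat.cast_mul, Nat.cast_succ]
  by_cases hc : poch c i = 0
  · simp [hc]
  · field_simp

open Finset in
/-- The first-order recurrence satisfied by the coefficients of `₂F₁(a,b; a+b+1/2; x)²`. -/
theorem sum_gaussCoeff_mul_succ (a b : ℝ) (n : ℕ)
    (h : ∀ j ≤ n, a + b + 1 / 2 + (j : ℝ) ≠ 0) :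
    ((n : ℝ) + 1) * (a + b + 1 / 2 + n) * (2 * a + 2 * b + n) *
        ∑ p ∈ antidiagonal (n + 1),
          gaussCoeff a b (a + b + 1 / 2) p.1 * gaussCoeff a b (a + b + 1 / 2) p.2 =
      (2 * a + n) * (2 * b + n) * (a + b + n) *
        ∑ p ∈ antidiagonal n,
          gaussCoeff a b (a + b + 1 / 2) p.1 * gaussCoeff a b (a + b + 1 / 2) p.2 := by
  set c := a + b + 1 / 2 with hc
  set u := gaussCoeff a b c with hu
  let f : ℕ → ℕ → ℝ := fun i j =>
    (i : ℝ) * (i + (c - 1)) * (i + 3 * j + 2 * (c - 1)) * (u i * u j)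
  let g : ℕ → ℕ → ℝ := fun i j =>
    (a + i) * (b + i) * (i + 3 * j + (2 * a + 2 * b)) * (u i * u j)
  have hf : ((n : ℝ) + 1) * (c + n) * (2 * a + 2 * b + n) *
      ∑ p ∈ antidiagonal (n + 1), u p.1 * u p.2 =
      ∑ p ∈ antidiagonal (n + 1), (f p.1 p.2 + f p.2 p.1) := by
    rw [mul_sum]
    refine sum_congr rfl fun p hp => ?_
    have hn : (n : ℝ) = p.1 + p.2 - 1 := by
      rw [eq_sub_iff_add_eq]
      exact_mod_cast (mem_antidiagonal.1 hp).symm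
    simp only [f, hn, hc]
    ring
  have hg : (2 * a + n) * (2 * b + n) * (a + b + n) * ∑ p ∈ antidiagonal n, u p.1 * u p.2 =
      ∑ p ∈ antidiagonal n, (g p.1 p.2 + g p.2 p.1) := by
    rw [mul_sum]
    refine sum_congr rfl fun p hp => ?_
    have hn : (n : ℝ) = p.1 + p.2 := by exact_mod_cast (mem_antidiagonal.1 hp).symm
    simp only [g, hn]
    ring
  have hfg : ∑ p ∈ antidiagonal (n + 1), f p.1 p.2 = ∑ p ∈ antidiagonal n, g p.1 p.2 := by
    rw [Nat.sum_antidiagonal_succ]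
    have h0 : f 0 (n + 1) = 0 := by simp [f]
    rw [h0, zero_add]
    refine sum_congr rfl fun p hp => ?_
    have hs := gaussCoeff_succ a b c p.1 (h p.1 (by have := mem_antidiagonal.1 hp; omega))
    rw [← hu] at hs
    simp only [f, g]
    push_cast
    linear_combination (p.1 + 3 * p.2 + (2 * a + 2 * b)) * u p.2 * hs
  rw [hf, hg, sum_antidiagonal_add_swap, sum_antidiagonal_add_swap, hfg]

/-- The Cauchy-product coefficient identity equivalent to Clausen's formula
`₂F₁(a,b; a+b+1/2; x)² = ₃F₂(2a,2b,a+b; a+b+1/2,2a+2b; x)`. -/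
theorem clausen_coefficients (a b : ℝ) (k : ℕ)
    (h : ∀ j : ℕ, j < k → a + b + 1 / 2 + j ≠ 0 ∧ 2 * a + 2 * b + j ≠ 0) :
    ∑ j ∈ Finset.range (k + 1),
      (poch a j * poch b j / (poch (a + b + 1 / 2) j * (Nat.factorial j : ℝ))) *
        (poch a (k - j) * poch b (k - j) /
          (poch (a + b + 1 / 2) (k - j) * (Nat.factorial (k - j) : ℝ))) =
      poch (2 * a) k * poch (2 * b) k * poch (a + b) k /
        (poch (a + b + 1 / 2) k * poch (2 * a + 2 * b) k * (Nat.factorial k : ℝ)) := by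
  change ∑ j ∈ Finset.range (k + 1), gaussCoeff a b (a + b + 1 / 2) j *
    gaussCoeff a b (a + b + 1 / 2) (k - j) = _
  rw [← Finset.Nat.sum_antidiagonal_eq_sum_range_succ (fun i j =>
    gaussCoeff a b (a + b + 1 / 2) i * gaussCoeff a b (a + b + 1 / 2) j)]
  induction k with
  | zero => simp [gaussCoeff, poch]
  | succ n ih =>
    have hrec := sum_gaussCoeff_mul_succ a b n fun j hj => (h j (Nat.lt_succ_of_le hj)).1
    rw [ih fun j hj => h j (Nat.lt_succ_of_lt hj)] at hrec
    obtain ⟨hc, hd⟩ := h n n.lt_succ_self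
    have hn : (n : ℝ) + 1 ≠ 0 := by positivity
    have hpc : poch (a + b + 1 / 2) n ≠ 0 :=
      poch_ne_zero fun j hj => (h j (Nat.lt_succ_of_lt hj)).1
    have hpd : poch (2 * a + 2 * b) n ≠ 0 :=
      poch_ne_zero fun j hj => (h j (Nat.lt_succ_of_lt hj)).2
    have hfac : (Nat.factorial n : ℝ) ≠ 0 := Nat.cast_ne_zero.2 n.factorial_ne_zero
    refine mul_left_cancel₀ (mul_ne_zero (mul_ne_zero hn hc) hd) (hrec.trans ?_)
    simp only [poch_succ, Nat.factorial_succ, Nat.cast_mul, Nat.cast_succ]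
    generalize poch (a + b + 1 / 2) n = P at *
    generalize a + b + 1 / 2 + (n : ℝ) = C at *
    generalize poch (2 * a + 2 * b) n = Q at *
    generalize 2 * a + 2 * b + (n : ℝ) = D at *
    field_simp
end

section
/- Define P_n(x) = ∑_{k=0}^{n} (-1)^k · C(n,k) · C(n+k,k) · ((1-x)/2)^k for natural numbers n and real x. Then for every natural number n, the function x ↦ P_n(x) is infinitely differentiable on ℝ and satisfies the Legendre differential equation (1 - x²) · P_n''(x) - 2x · P_n'(x) + n(n+1) · P_n(x) = 0 for all real x. -/
/-- The Legendre polynomial `P_n(x) = ∑_{k=0}^{n} (-1)^k C(n,k) C(n+k,k) ((1-x)/2)^k`. -/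
noncomputable def legendreP (n : ℕ) (x : ℝ) : ℝ :=
  ∑ k ∈ Finset.range (n + 1),
    (-1 : ℝ) ^ k * (n.choose k : ℝ) * ((n + k).choose k : ℝ) * ((1 - x) / 2) ^ k

/-- The coefficient of `((1 - x) / 2) ^ k` in the Legendre polynomial `P_n`. -/
noncomputable def legendreCoeff (n k : ℕ) : ℝ :=
  (-1 : ℝ) ^ k * (n.choose k : ℝ) * ((n + k).choose k : ℝ)

theorem legendreCoeff_succ_mul (n k : ℕ) :
    legendreCoeff n (k + 1) * ((k : ℝ) + 1) ^ 2 =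
      -(legendreCoeff n k * ((n : ℝ) * (n + 1) - k * (k + 1))) := by
  have h₁ : (n.choose (k + 1) : ℝ) * (k + 1) = n.choose k * ((n : ℝ) - k) := by
    rcases le_or_gt k n with h | h
    · have := Nat.choose_succ_right_eq n k
      rw [← Nat.cast_sub h]
      exact_mod_cast this
    · simp [Nat.choose_eq_zero_of_lt h, Nat.choose_eq_zero_of_lt (h.trans k.lt_succ_self)]
  have h₂ : ((n + (k + 1)).choose (k + 1) : ℝ) * (k + 1) =
      ((n : ℝ) + k + 1) * (n + k).choose k := by
    have := Nat.add_one_mul_choose_eq (n + k) k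
    exact_mod_cast this.symm
  unfold legendreCoeff
  calc _ = (-1 : ℝ) ^ (k + 1) * ((n.choose (k + 1) : ℝ) * (k + 1)) *
        (((n + (k + 1)).choose (k + 1) : ℝ) * (k + 1)) := by ring
    _ = _ := by rw [h₁, h₂]; ring

theorem hasDerivAt_half_one_sub_pow (k : ℕ) (x : ℝ) :
    HasDerivAt (fun x : ℝ => ((1 - x) / 2) ^ k)
      (-1 / 2 * k * ((1 - x) / 2) ^ (k - 1)) x := by
  have h : HasDerivAt (fun x : ℝ => (1 - x) / 2) (-1 / 2) x :=
    ((hasDerivAt_id x).const_sub 1).div_const 2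
  exact (h.fun_pow k).congr_deriv (by ring)

theorem deriv_legendreP (n : ℕ) :
    deriv (legendreP n) = fun x => ∑ k ∈ Finset.range (n + 1),
      legendreCoeff n k * (-1 / 2 * k * ((1 - x) / 2) ^ (k - 1)) :=
  funext fun x => (HasDerivAt.fun_sum fun k _ =>
    (hasDerivAt_half_one_sub_pow k x).const_mul (legendreCoeff n k)).deriv

theorem deriv_deriv_legendreP (n : ℕ) :
    deriv (deriv (legendreP n)) = fun x => ∑ k ∈ Finset.range (n + 1),
      legendreCoeff n k *
        (-1 / 2 * k * (-1 / 2 * (k - 1 : ℕ) * ((1 - x) / 2) ^ (k - 1 - 1))) := by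
  rw [deriv_legendreP]
  exact funext fun x => (HasDerivAt.fun_sum fun k _ =>
    ((hasDerivAt_half_one_sub_pow (k - 1) x).const_mul (-1 / 2 * (k : ℝ))).const_mul
      (legendreCoeff n k)).deriv

theorem contDiff_legendreP (n : ℕ) {m : WithTop ℕ∞} : ContDiff ℝ m (legendreP n) := by
  unfold legendreP
  fun_prop

/-- `P_n` is smooth and satisfies the Legendre differential equation
`(1-x²)P_n'' - 2xP_n' + n(n+1)P_n = 0`. -/
theorem legendre_differential_equation (n : ℕ) :
    ContDiff ℝ (⊤ : ℕ∞) (legendreP n) ∧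
    ∀ x : ℝ,
      (1 - x ^ 2) * deriv (deriv (legendreP n)) x - 2 * x * deriv (legendreP n) x +
        (n : ℝ) * ((n : ℝ) + 1) * legendreP n x = 0 := by
  refine ⟨contDiff_legendreP n, fun x => ?_⟩
  let g : ℕ → ℝ := fun k => legendreCoeff n k * (k : ℝ) ^ 2 * ((1 - x) / 2) ^ (k - 1)
  have hP : legendreP n x =
      ∑ k ∈ Finset.range (n + 1), legendreCoeff n k * ((1 - x) / 2) ^ k := rfl
  rw [deriv_deriv_legendreP, deriv_legendreP, hP]
  simp only [Finset.mul_sum]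
  rw [← Finset.sum_sub_distrib, ← Finset.sum_add_distrib]
  calc _ = ∑ k ∈ Finset.range (n + 1), (g k - g (k + 1)) := by
        refine Finset.sum_congr rfl fun k _ => ?_
        have hg : g (k + 1) =
            -(legendreCoeff n k * ((n : ℝ) * (n + 1) - k * (k + 1))) * ((1 - x) / 2) ^ k := by
          simp only [g, Nat.cast_add, Nat.cast_one, legendreCoeff_succ_mul, Nat.add_sub_cancel]
        rw [hg]
        rcases k with _ | _ | k
        · simp [g]; ring
        · simp [g]; ring
        · simp only [g, Nat.add_sub_cancel]
          push_cast
          ring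
    _ = 0 := by
        rw [Finset.sum_range_sub']
        simp [g, legendreCoeff]
end
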